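/- Let 0 < q < 1. There exist constants c₂ > c₁ > 0, depending only on q and ℓ, such that for every 1 ≤ i ≤ ℓ+1, every GT tableau r, and every move M = (m₁,…,m_i) admissible for r, the product ∏_{a=1}^{i−1} |X_a|^{1/2} · |Y_i|^{1/2} lies between c₁·q^{C(i,r,M)} and c₂·q^{C(i,r,M)}. Here X_a is the expression q^{−r_{a,m_a}+r_{a+1,m_{a+1}}−m_{a+1}+m_a} · ∏_{1≤t≤ℓ+2−a, t≠m_a} ([r_{a,t}−r_{a+1,m_{a+1}}−t+m_{a+1}]_q / [r_{a,t}−r_{a,m_a}−t+m_a]_q) · ∏_{1≤t≤ℓ+1−a, t≠m_{a+1}} ([r_{a+1,t}−r_{a,m_a}−t+m_a−1]_q / [r_{a+1,t}−r_{a+1,m_{a+1}}−t+m_{a+1}−1]_q), Y_i is the expression q^{(1−m_i+∑_{t=1}^{ℓ+1−i} r_{i+1,t} − ∑_{1≤t≤ℓ+2−i, t≠m_i} r_{i,t})} · (∏_{t=1}^{ℓ+1−i} [r_{i+1,t}−r_{i,m_i}−t+m_i−1]_q) / (∏_{1≤t≤ℓ+2−i, t≠m_i} [r_{i,t}−r_{i,m_i}−t+m_i]_q),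 and C(i,r,M) = ∑_{a=1}^{i−1} ( ∑_{min(m_a,m_{a+1}) ≤ b < max(m_a,m_{a+1})} H_{ab}(r) + 2·∑_{m_{a+1} < b < m_a} V_{ab}(r) ) + ∑_{m_i ≤ b < ℓ+2−i} H_{ib}(r), with empty sums equal to zero. -/

import Mathlib

def GTInRange (ℓ i j : ℕ) : Prop :=
  1 ≤ i ∧ i ≤ ℓ + 1 ∧ 1 ≤ j ∧ j ≤ ℓ + 2 - i

def IsGT (ℓ : ℕ) (r : ℕ → ℕ → ℕ) : Prop :=
  (∀ i j, ¬ GTInRange ℓ i j → r i j = 0) ∧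
  (∀ i j, GTInRange ℓ i j → GTInRange ℓ (i + 1) j → r (i + 1) j ≤ r i j) ∧
  (∀ i j, GTInRange ℓ (i + 1) j → GTInRange ℓ i (j + 1) → r i (j + 1) ≤ r (i + 1) j)

/-- `H_{ab}(r) = r_{a+1,b} - r_{a,b+1}`. -/
def Hgt (r : ℕ → ℕ → ℕ) (a b : ℕ) : ℤ := (r (a + 1) b : ℤ) - (r a (b + 1) : ℤ)

/-- `V_{ab}(r) = r_{ab} - r_{a+1,b}`. -/
def Vgt (r : ℕ → ℕ → ℕ) (a b : ℕ) : ℤ := (r a b : ℤ) - (r (a + 1) b : ℤ)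

/-- The `q`-number `[n]_q = (qⁿ - q⁻ⁿ)/(q - q⁻¹)`. -/
noncomputable def qnum (q : ℝ) (n : ℤ) : ℝ := (q ^ n - q ^ (-n)) / (q - q⁻¹)

/-- The array `M(r)` obtained from `r` by adding `1` to the entry `r_{a, m_a}`
for each `1 ≤ a ≤ i`. -/
def moveGT (r : ℕ → ℕ → ℕ) (i : ℕ) (M : ℕ → ℕ) : ℕ → ℕ → ℕ :=
  fun a b => if 1 ≤ a ∧ a ≤ i ∧ b = M a then r a b + 1 else r a b

/-- The quantity `X_a` of STATEMENT 6, with `j = m_a`, `k = m_{a+1}`. -/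
noncomputable def Xfac (ℓ : ℕ) (q : ℝ) (r : ℕ → ℕ → ℕ) (a j k : ℕ) : ℝ :=
  q ^ (-(r a j : ℤ) + (r (a + 1) k : ℤ) - (k : ℤ) + (j : ℤ)) *
    (∏ t ∈ (Finset.Icc 1 (ℓ + 2 - a)).erase j,
      qnum q ((r a t : ℤ) - (r (a + 1) k : ℤ) - (t : ℤ) + (k : ℤ)) /
        qnum q ((r a t : ℤ) - (r a j : ℤ) - (t : ℤ) + (j : ℤ))) *
    (∏ t ∈ (Finset.Icc 1 (ℓ + 1 - a)).erase k,
      qnum q ((r (a + 1) t : ℤ) - (r a j : ℤ) - (t : ℤ) + (j : ℤ) - 1) /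
        qnum q ((r (a + 1) t : ℤ) - (r (a + 1) k : ℤ) - (t : ℤ) + (k : ℤ) - 1))

/-- The quantity `Y_i` of STATEMENT 6, with `j = m_i`. -/
noncomputable def Yfac (ℓ : ℕ) (q : ℝ) (r : ℕ → ℕ → ℕ) (a j : ℕ) : ℝ :=
  q ^ ((1 : ℤ) - (j : ℤ) + (∑ t ∈ Finset.Icc 1 (ℓ + 1 - a), (r (a + 1) t : ℤ)) -
        ∑ t ∈ (Finset.Icc 1 (ℓ + 2 - a)).erase j, (r a t : ℤ)) *
    (∏ t ∈ Finset.Icc 1 (ℓ + 1 - a),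
      qnum q ((r (a + 1) t : ℤ) - (r a j : ℤ) - (t : ℤ) + (j : ℤ) - 1)) /
    (∏ t ∈ (Finset.Icc 1 (ℓ + 2 - a)).erase j,
      qnum q ((r a t : ℤ) - (r a j : ℤ) - (t : ℤ) + (j : ℤ)))

/-- `C(i, r, M)` of STATEMENT 6. -/
def Cexp (ℓ i : ℕ) (r : ℕ → ℕ → ℕ) (M : ℕ → ℕ) : ℤ :=
  (∑ a ∈ Finset.Icc 1 (i - 1),
    ((∑ b ∈ Finset.Ico (min (M a) (M (a + 1))) (max (M a) (M (a + 1))), Hgt r a b) +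
      2 * ∑ b ∈ Finset.Ioo (M (a + 1)) (M a), Vgt r a b)) +
    ∑ b ∈ Finset.Ico (M i) (ℓ + 2 - i), Hgt r i b

/-! ### Comparison with powers of `q` up to a bounded factor -/

/-- `x` agrees with `q ^ e` up to a factor between `q ^ N` and `q ^ (-N)`. -/
def QComp (q : ℝ) (N : ℕ) (e : ℤ) (x : ℝ) : Prop :=
  q ^ (e + N) ≤ x ∧ x ≤ q ^ (e - N)

namespace QComp

variable {q : ℝ} {N N' : ℕ} {e e' : ℤ} {x y : ℝ}

lemma pos (hq0 : 0 < q) (h : QComp q N e x) : 0 < x :=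
  (zpow_pos hq0 _).trans_le h.1

lemma shift (hq0 : 0 < q) (hq1 : q < 1) (d : ℕ) (h : QComp q N e x) (hd : |e - e'| ≤ d) :
    QComp q (N + d) e' x := by
  obtain ⟨h1, h2⟩ := abs_le.mp hd
  refine ⟨(zpow_le_zpow_right_of_le_one₀ hq0 hq1.le ?_).trans h.1,
    h.2.trans (zpow_le_zpow_right_of_le_one₀ hq0 hq1.le ?_)⟩ <;> push_cast <;> omega

lemma mono (hq0 : 0 < q) (hq1 : q < 1) (h : QComp q N e x) (hN : N ≤ N') :
    QComp q N' e x := by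
  obtain ⟨d, rfl⟩ := Nat.exists_eq_add_of_le hN
  exact h.shift hq0 hq1 d (by simp)

lemma zpow (q : ℝ) (e : ℤ) : QComp q 0 e (q ^ e) := by
  simp [QComp]

lemma mul (hq0 : 0 < q) (hx : QComp q N e x) (hy : QComp q N' e' y) :
    QComp q (N + N') (e + e') (x * y) := by
  have h1 : e + e' + ((N + N' : ℕ) : ℤ) = (e + N) + (e' + N') := by push_cast; ring
  have h2 : e + e' - ((N + N' : ℕ) : ℤ) = (e - N) + (e' - N') := by push_cast; ring
  rw [QComp, h1, h2, zpow_add₀ hq0.ne' (e + N), zpow_add₀ hq0.ne' (e - N)]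
  exact ⟨mul_le_mul hx.1 hy.1 (zpow_pos hq0 _).le (hx.pos hq0).le,
    mul_le_mul hx.2 hy.2 (hy.pos hq0).le (zpow_pos hq0 _).le⟩

lemma inv (hq0 : 0 < q) (hx : QComp q N e x) : QComp q N (-e) x⁻¹ := by
  have h1 : -e + (N : ℤ) = -(e - N) := by ring
  have h2 : -e - (N : ℤ) = -(e + N) := by ring
  rw [QComp, h1, h2, zpow_neg, zpow_neg]
  exact ⟨inv_anti₀ (hx.pos hq0) hx.2, inv_anti₀ (zpow_pos hq0 _) hx.1⟩

lemma div (hq0 : 0 < q) (hx : QComp q N e x) (hy : QComp q N' e' y) :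
    QComp q (N + N') (e - e') (x / y) := by
  rw [div_eq_mul_inv, sub_eq_add_neg]
  exact hx.mul hq0 (hy.inv hq0)

lemma prod (hq0 : 0 < q) {s : Finset ℕ} {f : ℕ → ℝ} {g : ℕ → ℤ}
    (h : ∀ t ∈ s, QComp q N (g t) (f t)) :
    QComp q (s.card * N) (∑ t ∈ s, g t) (∏ t ∈ s, f t) := by
  induction s using Finset.cons_induction with
  | empty => simp [QComp]
  | cons a s ha ih =>
    rw [Finset.prod_cons, Finset.sum_cons, Finset.card_cons, add_one_mul, add_comm (_ * N)]
    exact (h a (by simp)).mul hq0 (ih fun t ht => h t (by simp [ht]))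

lemma sqrt (hq0 : 0 < q) (hq1 : q < 1) (h : QComp q N (2 * e) x) :
    QComp q N e (Real.sqrt x) := by
  constructor
  · apply Real.le_sqrt_of_sq_le
    refine le_trans ?_ h.1
    rw [← zpow_natCast, ← zpow_mul]
    exact zpow_le_zpow_right_of_le_one₀ hq0 hq1.le (by push_cast; omega)
  · rw [Real.sqrt_le_left (zpow_pos hq0 _).le]
    refine h.2.trans ?_
    rw [← zpow_natCast, ← zpow_mul]
    exact zpow_le_zpow_right_of_le_one₀ hq0 hq1.le (by push_cast; omega)

end QComp

lemma qnum_neg (q : ℝ) (n : ℤ) : qnum q (-n) = -qnum q n := by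
  simp only [qnum, neg_neg]
  ring

lemma abs_qnum_eq {q : ℝ} (hq0 : 0 < q) (hq1 : q < 1) (n : ℤ) :
    |qnum q n| = q ^ (-|n|) * ((1 - q ^ (2 * |n|)) / (q⁻¹ - q)) := by
  have hd : 0 < q⁻¹ - q := by
    have := one_lt_inv_iff₀.mpr ⟨hq0, hq1⟩
    linarith
  have key : ∀ m : ℤ, 0 ≤ m → |qnum q m| = q ^ (-m) * ((1 - q ^ (2 * m)) / (q⁻¹ - q)) := by
    intro m hm
    have h1 : q ^ (2 * m) ≤ 1 := zpow_le_one₀ hq0 hq1.le (by omega)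
    have h2 : qnum q m = q ^ (-m) * ((1 - q ^ (2 * m)) / (q⁻¹ - q)) := by
      have h3 : q ^ (-m) * q ^ (2 * m) = q ^ m := by
        rw [← zpow_add₀ hq0.ne']; congr 1; ring
      rw [qnum, ← mul_div_assoc, mul_sub, h3, mul_one, ← neg_div_neg_eq]
      congr 1 <;> ring
    rw [h2, abs_of_nonneg]
    exact mul_nonneg (zpow_pos hq0 _).le (div_nonneg (by linarith) hd.le)
  rcases le_total 0 n with hn | hn
  · rw [abs_of_nonneg hn, key n hn]
  · rw [abs_of_nonpos hn, ← key (-n) (by omega), qnum_neg, abs_neg]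

lemma exists_qComp_qnum {q : ℝ} (hq0 : 0 < q) (hq1 : q < 1) :
    ∃ N : ℕ, ∀ n : ℤ, n ≠ 0 → QComp q N (-|n|) |qnum q n| := by
  have hd : 0 < q⁻¹ - q := by
    have := one_lt_inv_iff₀.mpr ⟨hq0, hq1⟩
    linarith
  obtain ⟨N, hN⟩ := exists_pow_lt_of_lt_one (lt_min (inv_pos.mpr (inv_pos.mpr hd)) hq0) hq1
  have hNd : q ^ N ≤ q⁻¹ - q := by
    simpa using (hN.trans_le (min_le_left _ _)).le
  have hNq : q ^ N ≤ q := (hN.trans_le (min_le_right _ _)).le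
  refine ⟨N, fun n hn => ?_⟩
  have hn1 : 1 ≤ |n| := Int.one_le_abs hn
  have h1 : q ^ (2 * |n|) ≤ q * q :=
    (zpow_le_zpow_right_of_le_one₀ hq0 hq1.le (by omega)).trans_eq (zpow_two q)
  have h2 : 0 < q ^ (2 * |n|) := zpow_pos hq0 _
  have h4 : q * (q⁻¹ - q) = 1 - q * q := by rw [mul_sub, mul_inv_cancel₀ hq0.ne']
  rw [abs_qnum_eq hq0 hq1]
  constructor
  · rw [zpow_add₀ hq0.ne', zpow_natCast]
    refine mul_le_mul_of_nonneg_left (hNq.trans ?_) (zpow_pos hq0 _).le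
    rw [le_div_iff₀ hd, h4]
    linarith
  · rw [zpow_sub₀ hq0.ne', zpow_natCast, div_eq_mul_inv _ (q ^ N)]
    refine mul_le_mul_of_nonneg_left ?_ (zpow_pos hq0 _).le
    rw [div_le_iff₀ hd, inv_mul_eq_div, le_div_iff₀ (by positivity)]
    nlinarith [pow_pos hq0 N]

/-! ### Interlacing sequences -/

/-- `A 1 ≥ B 1 ≥ A 2 ≥ B 2 ≥ ⋯ ≥ B (n - 1) ≥ A n`. -/
def Interlaced (n : ℕ) (A B : ℕ → ℤ) : Prop :=
  ∀ t, 1 ≤ t → t < n → B t ≤ A t ∧ A (t + 1) ≤ B t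

namespace Interlaced

variable {n j k : ℕ} {A B : ℕ → ℤ}

lemma antitone_left (h : Interlaced n A B) {s t : ℕ} (hs : 1 ≤ s) (hst : s ≤ t) (ht : t ≤ n) :
    A t ≤ A s := by
  induction t, hst using Nat.le_induction with
  | base => exact le_rfl
  | succ t hst ih =>
    have := h t (by omega) (by omega)
    have := ih (by omega)
    omega

lemma left_le_right (h : Interlaced n A B) {s t : ℕ} (hs : 1 ≤ s) (hst : s < t) (ht : t ≤ n) :
    A t ≤ B s :=
  (h.antitone_left (by omega) hst ht).trans (h s hs (by omega)).2

lemma right_le_left (h : Interlaced n A B) {s t : ℕ} (hs : 1 ≤ s) (hst : s ≤ t) (ht : t < n) :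
    B t ≤ A s :=
  (h t (by omega) ht).1.trans (h.antitone_left hs hst ht.le)

lemma antitone_right (h : Interlaced n A B) {s t : ℕ} (hs : 1 ≤ s) (hst : s ≤ t) (ht : t < n) :
    B t ≤ B s := by
  rcases hst.eq_or_lt with rfl | hlt
  · exact le_rfl
  · exact (h t (by omega) ht).1.trans (h.left_le_right hs hlt ht.le)

end Interlaced

lemma sum_Icc_split (f : ℕ → ℤ) {n j : ℕ} (hj1 : 1 ≤ j) (hjn : j ≤ n) :
    ∑ t ∈ Finset.Icc 1 n, f t =
      ∑ t ∈ Finset.Ico 1 j, f t + f j + ∑ t ∈ Finset.Ico j n, f (t + 1) := by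
  have h1 : Finset.Icc 1 n = Finset.Ico 1 (n + 1) := by ext; simp
  rw [h1, ← Finset.sum_Ico_consecutive f hj1 (by omega : j ≤ n + 1),
    Finset.sum_eq_sum_Ico_succ_bot (by omega : j < n + 1), Finset.sum_Ico_add' f j n 1]
  ring

lemma sum_Icc_pred_split (f : ℕ → ℤ) {n j : ℕ} (hj1 : 1 ≤ j) (hjn : j ≤ n) :
    ∑ t ∈ Finset.Icc 1 (n - 1), f t =
      ∑ t ∈ Finset.Ico 1 j, f t + ∑ t ∈ Finset.Ico j n, f t := by
  have h1 : Finset.Icc 1 (n - 1) = Finset.Ico 1 n := by ext; simp; omega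
  rw [h1, Finset.sum_Ico_consecutive f hj1 hjn]

/-- The alternating sum of distances from `x` to two sequences. -/
def distSum (n : ℕ) (A B : ℕ → ℤ) (x : ℤ) : ℤ :=
  ∑ t ∈ Finset.Icc 1 n, |A t - x| - ∑ t ∈ Finset.Icc 1 (n - 1), |B t - x|

lemma Interlaced.distSum_eq {n j : ℕ} {A B : ℕ → ℤ} (h : Interlaced n A B) (hj1 : 1 ≤ j)
    (hjn : j ≤ n) {x : ℤ} (hlo : ∀ t, 1 ≤ t → t < j → x ≤ B t)
    (hhi : ∀ t, j ≤ t → t < n → B t ≤ x) :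
    distSum n A B x = ∑ t ∈ Finset.Ico 1 j, (A t - B t) + |A j - x| +
      ∑ t ∈ Finset.Ico j n, (B t - A (t + 1)) := by
  have h1 : ∑ t ∈ Finset.Ico 1 j, (A t - B t) =
      ∑ t ∈ Finset.Ico 1 j, (|A t - x| - |B t - x|) := by
    refine Finset.sum_congr rfl fun t ht => ?_
    rw [Finset.mem_Ico] at ht
    have := hlo t ht.1 ht.2
    have := h t ht.1 (by omega)
    rw [abs_of_nonneg (by omega), abs_of_nonneg (by omega)]
    ring
  have h2 : ∑ t ∈ Finset.Ico j n, (B t - A (t + 1)) =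
      ∑ t ∈ Finset.Ico j n, (|A (t + 1) - x| - |B t - x|) := by
    refine Finset.sum_congr rfl fun t ht => ?_
    rw [Finset.mem_Ico] at ht
    have := hhi t ht.1 ht.2
    have := h t (by omega) ht.2
    rw [abs_of_nonpos (by omega), abs_of_nonpos (by omega)]
    ring
  rw [h1, h2, distSum, sum_Icc_split _ hj1 hjn, sum_Icc_pred_split _ hj1 hjn]
  simp only [Finset.sum_sub_distrib]
  ring

lemma Interlaced.distSum_left {n j : ℕ} {A B : ℕ → ℤ} (h : Interlaced n A B) (hj1 : 1 ≤ j)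
    (hjn : j ≤ n) :
    distSum n A B (A j) = ∑ t ∈ Finset.Ico 1 j, (A t - B t) +
      ∑ t ∈ Finset.Ico j n, (B t - A (t + 1)) := by
  rw [h.distSum_eq hj1 hjn (fun t h1 h2 => h.left_le_right h1 h2 hjn)
    (fun t h1 h2 => h.right_le_left hj1 h1 h2)]
  simp

lemma Interlaced.distSum_right {n k : ℕ} {A B : ℕ → ℤ} (h : Interlaced n A B) (hk1 : 1 ≤ k)
    (hkn : k < n) :
    distSum n A B (B k) = ∑ t ∈ Finset.Ico 1 k, (A t - B t) + (A k - B k) +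
      ∑ t ∈ Finset.Ico k n, (B t - A (t + 1)) := by
  rw [h.distSum_eq hk1 hkn.le (fun t h1 h2 => h.antitone_right h1 h2.le hkn)
    (fun t h1 h2 => h.antitone_right hk1 h1 h2), abs_of_nonneg]
  have := h k hk1 hkn
  omega

lemma sum_Ico_telescope (A B : ℕ → ℤ) {j k : ℕ} (hjk : j ≤ k) :
    ∑ t ∈ Finset.Ico j k, (A t - B t) + ∑ t ∈ Finset.Ico j k, (B t - A (t + 1)) = A j - A k := by
  induction k, hjk using Nat.le_induction with
  | base => simp
  | succ k hjk ih =>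
    rw [Finset.sum_Ico_succ_top hjk, Finset.sum_Ico_succ_top hjk]
    linarith

/-- The power of `q` governing the size of `Xfac`. -/
lemma Interlaced.exponent_X {n j k : ℕ} {A B : ℕ → ℤ} (h : Interlaced n A B) (hj1 : 1 ≤ j)
    (hjn : j ≤ n) (hk1 : 1 ≤ k) (hkn : k < n) :
    (-A j + B k) +
        ∑ t ∈ (Finset.Icc 1 n).erase j, (-|A t - B k| - -|A t - A j|) +
        ∑ t ∈ (Finset.Icc 1 (n - 1)).erase k, (-|B t - A j| - -|B t - B k|) =
      2 * (∑ b ∈ Finset.Ico (min j k) (max j k), (B b - A (b + 1)) +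
        2 * ∑ b ∈ Finset.Ioo k j, (A b - B b)) := by
  have e1 := Finset.add_sum_erase (Finset.Icc 1 n)
    (fun t => -|A t - B k| - -|A t - A j|) (Finset.mem_Icc.mpr ⟨hj1, hjn⟩)
  have e2 := Finset.add_sum_erase (Finset.Icc 1 (n - 1))
    (fun t => -|B t - A j| - -|B t - B k|) (Finset.mem_Icc.mpr ⟨hk1, by omega⟩)
  have dl := h.distSum_left hj1 hjn
  have dr := h.distSum_right hk1 hkn
  simp only [distSum] at dl dr
  simp only [Finset.sum_sub_distrib, Finset.sum_neg_distrib, sub_self, abs_zero, neg_zero,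
    sub_zero] at e1 e2 dl dr ⊢
  rcases le_or_gt j k with hjk | hjk
  · have hle := h.right_le_left hj1 hjk hkn
    rw [min_eq_left hjk, max_eq_right hjk, Finset.Ioo_eq_empty (by omega)]
    rw [abs_of_nonneg (by omega : 0 ≤ A j - B k)] at e1
    rw [abs_of_nonpos (by omega : B k - A j ≤ 0)] at e2
    have s1 := Finset.sum_Ico_consecutive A hj1 hjk
    have s2 := Finset.sum_Ico_consecutive B hj1 hjk
    have s3 := Finset.sum_Ico_consecutive B hjk hkn.le
    have s4 := Finset.sum_Ico_consecutive (fun t => A (t + 1)) hjk hkn.le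
    have tel := sum_Ico_telescope A B hjk
    simp only [Finset.sum_sub_distrib, Finset.sum_empty] at tel ⊢
    linarith
  · have hle := h.left_le_right hk1 hjk hjn
    rw [min_eq_right hjk.le, max_eq_left hjk.le]
    rw [abs_of_nonpos (by omega : A j - B k ≤ 0)] at e1
    rw [abs_of_nonneg (by omega : 0 ≤ B k - A j)] at e2
    have s1 := Finset.sum_Ico_consecutive A hk1 hjk.le
    have s2 := Finset.sum_Ico_consecutive B hk1 hjk.le
    have s3 := Finset.sum_Ico_consecutive B hjk.le hjn
    have s4 := Finset.sum_Ico_consecutive (fun t => A (t + 1)) hjk.le hjn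
    have tel := sum_Ico_telescope A B hjk.le
    have i1 := Finset.sum_eq_sum_Ico_succ_bot hjk A
    have i2 := Finset.sum_eq_sum_Ico_succ_bot hjk B
    have hI : Finset.Ioo k j = Finset.Ico (k + 1) j := by ext; simp
    rw [hI]
    simp only [Finset.sum_sub_distrib] at tel ⊢
    linarith

/-- The power of `q` governing the size of `Yfac`. -/
lemma Interlaced.exponent_Y {n j : ℕ} {A B : ℕ → ℤ} (h : Interlaced n A B) (hj1 : 1 ≤ j)
    (hjn : j ≤ n) :
    (∑ t ∈ Finset.Icc 1 (n - 1), B t - ∑ t ∈ (Finset.Icc 1 n).erase j, A t) +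
        ∑ t ∈ Finset.Icc 1 (n - 1), -|B t - A j| -
        ∑ t ∈ (Finset.Icc 1 n).erase j, -|A t - A j| =
      2 * ∑ b ∈ Finset.Ico j n, (B b - A (b + 1)) := by
  have hj : j ∈ Finset.Icc 1 n := Finset.mem_Icc.mpr ⟨hj1, hjn⟩
  have e1 := Finset.add_sum_erase (Finset.Icc 1 n) A hj
  have e2 := Finset.add_sum_erase (Finset.Icc 1 n) (fun t => |A t - A j|) hj
  have dl := h.distSum_left hj1 hjn
  have sA := sum_Icc_split A hj1 hjn
  have sB := sum_Icc_pred_split B hj1 hjn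
  simp only [distSum] at dl
  simp only [Finset.sum_sub_distrib, Finset.sum_neg_distrib, sub_self, abs_zero] at e2 dl ⊢
  linarith

/-! ### Sizes of the factors -/

lemma QComp.qnum_of_near {q : ℝ} (hq0 : 0 < q) (hq1 : q < 1) {N : ℕ}
    (hN : ∀ n : ℤ, n ≠ 0 → QComp q N (-|n|) |qnum q n|) (d : ℕ) {n m : ℤ} (hn : n ≠ 0)
    (hd : |n - m| ≤ d) : QComp q (N + d) (-|m|) |qnum q n| := by
  refine (hN n hn).shift hq0 hq1 d ?_
  have := abs_abs_sub_abs_le_abs_sub n m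
  rw [show -|n| - -|m| = -(|n| - |m|) by ring, abs_neg]
  exact this.trans hd

lemma QComp.prod_le {q : ℝ} (hq0 : 0 < q) (hq1 : q < 1) {N c : ℕ} {s : Finset ℕ}
    {f : ℕ → ℝ} {g : ℕ → ℤ} (hc : s.card ≤ c) (h : ∀ t ∈ s, QComp q N (g t) (f t)) :
    QComp q (c * N) (∑ t ∈ s, g t) (∏ t ∈ s, f t) :=
  (QComp.prod hq0 h).mono hq0 hq1 (Nat.mul_le_mul_right N hc)

lemma IsGT.interlaced {ℓ : ℕ} {r : ℕ → ℕ → ℕ} (h : IsGT ℓ r) {a : ℕ} (ha : 1 ≤ a) :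
    Interlaced (ℓ + 2 - a) (fun t => (r a t : ℤ)) (fun t => (r (a + 1) t : ℤ)) := by
  intro t ht1 htn
  have h1 := h.2.1 a t ⟨ha, by omega, ht1, by omega⟩ ⟨by omega, by omega, ht1, by omega⟩
  have h2 := h.2.2 a t ⟨by omega, by omega, ht1, by omega⟩ ⟨ha, by omega, by omega, by omega⟩
  exact ⟨Int.ofNat_le.mpr h1, Int.ofNat_le.mpr h2⟩

lemma qComp_Xfac {ℓ : ℕ} {q : ℝ} (hq0 : 0 < q) (hq1 : q < 1) {N : ℕ}
    (hN : ∀ n : ℤ, n ≠ 0 → QComp q N (-|n|) |qnum q n|) {r : ℕ → ℕ → ℕ} (hr : IsGT ℓ r)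
    {a j k : ℕ} (ha : 1 ≤ a) (hj1 : 1 ≤ j) (hjn : j ≤ ℓ + 2 - a) (hk1 : 1 ≤ k)
    (hkn : k ≤ ℓ + 1 - a) (hV : k ≠ j → r (a + 1) k < r a k)
    (hH : ∀ t, 1 ≤ t → t + 1 = j → t ≠ k → r a j < r (a + 1) t)
    (hR : ∀ t, 1 ≤ t → t + 1 = k → r (a + 1) k < r (a + 1) t) :
    QComp q (4 * (ℓ + 2) * (N + (ℓ + 2)) + (ℓ + 2))
      (2 * (∑ b ∈ Finset.Ico (min j k) (max j k), Hgt r a b +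
        2 * ∑ b ∈ Finset.Ioo k j, Vgt r a b)) |Xfac ℓ q r a j k| := by
  have hI := hr.interlaced ha
  have hn1 : ℓ + 1 - a = ℓ + 2 - a - 1 := by omega
  have hpre : QComp q (ℓ + 2) (-(r a j : ℤ) + (r (a + 1) k : ℤ))
      (q ^ (-(r a j : ℤ) + (r (a + 1) k : ℤ) - (k : ℤ) + (j : ℤ))) := by
    simpa using (QComp.zpow q _).shift hq0 hq1 (ℓ + 2)
      (e' := -(r a j : ℤ) + (r (a + 1) k : ℤ)) (abs_le.mpr ⟨by omega, by omega⟩)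
  have hp1 : QComp q ((ℓ + 2) * ((N + (ℓ + 2)) + (N + (ℓ + 2))))
      (∑ t ∈ (Finset.Icc 1 (ℓ + 2 - a)).erase j,
        (-|(r a t : ℤ) - r (a + 1) k| - -|(r a t : ℤ) - r a j|))
      (∏ t ∈ (Finset.Icc 1 (ℓ + 2 - a)).erase j,
        (|qnum q ((r a t : ℤ) - (r (a + 1) k : ℤ) - (t : ℤ) + (k : ℤ))| /
        |qnum q ((r a t : ℤ) - (r a j : ℤ) - (t : ℤ) + (j : ℤ))|)) := by
    refine QComp.prod_le hq0 hq1 ?_ fun t ht => ?_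
    · refine (Finset.card_le_card (Finset.erase_subset _ _)).trans ?_
      rw [Nat.card_Icc]; omega
    · rw [Finset.mem_erase, Finset.mem_Icc] at ht
      obtain ⟨htj, ht1, htn⟩ := ht
      refine QComp.div hq0
        (QComp.qnum_of_near hq0 hq1 hN _ ?_ (abs_le.mpr ⟨by push_cast; omega, by push_cast; omega⟩))
        (QComp.qnum_of_near hq0 hq1 hN _ ?_ (abs_le.mpr ⟨by push_cast; omega, by push_cast; omega⟩))
      · rcases lt_trichotomy t k with h | h | h
        · have := hI.right_le_left ht1 h.le (by omega)
          omega
        · subst h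
          have := hV htj
          omega
        · have := hI.left_le_right hk1 h htn
          omega
      · rcases lt_or_gt_of_ne htj with h | h
        · have := hI.antitone_left ht1 h.le hjn
          omega
        · have := hI.antitone_left hj1 h.le htn
          omega
  have hp2 : QComp q ((ℓ + 2) * ((N + (ℓ + 2)) + (N + (ℓ + 2))))
      (∑ t ∈ (Finset.Icc 1 (ℓ + 1 - a)).erase k,
        (-|(r (a + 1) t : ℤ) - r a j| - -|(r (a + 1) t : ℤ) - r (a + 1) k|))
      (∏ t ∈ (Finset.Icc 1 (ℓ + 1 - a)).erase k,
        (|qnum q ((r (a + 1) t : ℤ) - (r a j : ℤ) - (t : ℤ) + (j : ℤ) - 1)| /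
        |qnum q ((r (a + 1) t : ℤ) - (r (a + 1) k : ℤ) - (t : ℤ) + (k : ℤ) - 1)|)) := by
    refine QComp.prod_le hq0 hq1 ?_ fun t ht => ?_
    · refine (Finset.card_le_card (Finset.erase_subset _ _)).trans ?_
      rw [Nat.card_Icc]; omega
    · rw [Finset.mem_erase, Finset.mem_Icc] at ht
      obtain ⟨htk, ht1, htn⟩ := ht
      refine QComp.div hq0
        (QComp.qnum_of_near hq0 hq1 hN _ ?_ (abs_le.mpr ⟨by push_cast; omega, by push_cast; omega⟩))
        (QComp.qnum_of_near hq0 hq1 hN _ ?_ (abs_le.mpr ⟨by push_cast; omega, by push_cast; omega⟩))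
      · rcases lt_or_ge t j with h | h
        · have := hI.left_le_right ht1 h hjn
          have := hH t ht1
          omega
        · have := hI.right_le_left hj1 h (by omega)
          omega
      · rcases lt_or_gt_of_ne htk with h | h
        · have := hI.antitone_right ht1 h.le (by omega)
          have := hR t ht1
          omega
        · have := hI.antitone_right hk1 h.le (by omega)
          omega
  have htot := (hpre.mul hq0 hp1).mul hq0 hp2
  have hE := hI.exponent_X hj1 hjn hk1 (by omega)
  simp only [← hn1] at hE
  rw [hE] at htot
  rw [Xfac, abs_mul, abs_mul, Finset.abs_prod, Finset.abs_prod, abs_of_pos (zpow_pos hq0 _)]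
  simp only [abs_div]
  exact htot.mono hq0 hq1 (by nlinarith)

lemma qComp_Yfac {ℓ : ℕ} {q : ℝ} (hq0 : 0 < q) (hq1 : q < 1) {N : ℕ}
    (hN : ∀ n : ℤ, n ≠ 0 → QComp q N (-|n|) |qnum q n|) {r : ℕ → ℕ → ℕ} (hr : IsGT ℓ r)
    {a j : ℕ} (ha : 1 ≤ a) (hj1 : 1 ≤ j) (hjn : j ≤ ℓ + 2 - a)
    (hH : ∀ t, 1 ≤ t → t + 1 = j → r a j < r (a + 1) t) :
    QComp q (4 * (ℓ + 2) * (N + (ℓ + 2)) + (ℓ + 2))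
      (2 * ∑ b ∈ Finset.Ico j (ℓ + 2 - a), Hgt r a b) |Yfac ℓ q r a j| := by
  have hI := hr.interlaced ha
  have hn1 : ℓ + 1 - a = ℓ + 2 - a - 1 := by omega
  have hpre : QComp q (ℓ + 2) ((∑ t ∈ Finset.Icc 1 (ℓ + 1 - a), (r (a + 1) t : ℤ)) -
        ∑ t ∈ (Finset.Icc 1 (ℓ + 2 - a)).erase j, (r a t : ℤ))
      (q ^ ((1 : ℤ) - (j : ℤ) + (∑ t ∈ Finset.Icc 1 (ℓ + 1 - a), (r (a + 1) t : ℤ)) -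
        ∑ t ∈ (Finset.Icc 1 (ℓ + 2 - a)).erase j, (r a t : ℤ))) := by
    simpa using (QComp.zpow q _).shift hq0 hq1 (ℓ + 2)
      (e' := (∑ t ∈ Finset.Icc 1 (ℓ + 1 - a), (r (a + 1) t : ℤ)) -
        ∑ t ∈ (Finset.Icc 1 (ℓ + 2 - a)).erase j, (r a t : ℤ))
      (abs_le.mpr ⟨by push_cast; omega, by push_cast; omega⟩)
  have hp1 : QComp q ((ℓ + 2) * (N + (ℓ + 2)))
      (∑ t ∈ Finset.Icc 1 (ℓ + 1 - a), -|(r (a + 1) t : ℤ) - r a j|)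
      (∏ t ∈ Finset.Icc 1 (ℓ + 1 - a),
        |qnum q ((r (a + 1) t : ℤ) - (r a j : ℤ) - (t : ℤ) + (j : ℤ) - 1)|) := by
    refine QComp.prod_le hq0 hq1 ?_ fun t ht => ?_
    · rw [Nat.card_Icc]; omega
    · rw [Finset.mem_Icc] at ht
      obtain ⟨ht1, htn⟩ := ht
      refine QComp.qnum_of_near hq0 hq1 hN _ ?_
        (abs_le.mpr ⟨by push_cast; omega, by push_cast; omega⟩)
      rcases lt_or_ge t j with h | h
      · have := hI.left_le_right ht1 h hjn
        have := hH t ht1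
        omega
      · have := hI.right_le_left hj1 h (by omega)
        omega
  have hp2 : QComp q ((ℓ + 2) * (N + (ℓ + 2)))
      (∑ t ∈ (Finset.Icc 1 (ℓ + 2 - a)).erase j, -|(r a t : ℤ) - r a j|)
      (∏ t ∈ (Finset.Icc 1 (ℓ + 2 - a)).erase j,
        |qnum q ((r a t : ℤ) - (r a j : ℤ) - (t : ℤ) + (j : ℤ))|) := by
    refine QComp.prod_le hq0 hq1 ?_ fun t ht => ?_
    · refine (Finset.card_le_card (Finset.erase_subset _ _)).trans ?_
      rw [Nat.card_Icc]; omega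
    · rw [Finset.mem_erase, Finset.mem_Icc] at ht
      obtain ⟨htj, ht1, htn⟩ := ht
      refine QComp.qnum_of_near hq0 hq1 hN _ ?_
        (abs_le.mpr ⟨by push_cast; omega, by push_cast; omega⟩)
      rcases lt_or_gt_of_ne htj with h | h
      · have := hI.antitone_left ht1 h.le hjn
        omega
      · have := hI.antitone_left hj1 h.le htn
        omega
  have htot := (hpre.mul hq0 hp1).div hq0 hp2
  have hE := hI.exponent_Y hj1 hjn
  simp only [← hn1] at hE
  rw [hE] at htot
  rw [Yfac, abs_div, abs_mul, Finset.abs_prod, Finset.abs_prod, abs_of_pos (zpow_pos hq0 _)]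
  exact htot.mono hq0 hq1 (by nlinarith)

/-! ### Consequences of admissibility -/

section Admissible

variable {ℓ i : ℕ} {r : ℕ → ℕ → ℕ} {M : ℕ → ℕ}

lemma moveGT_self {a : ℕ} (ha : 1 ≤ a) (hai : a ≤ i) : moveGT r i M a (M a) = r a (M a) + 1 := by
  simp [moveGT, ha, hai]

lemma moveGT_of_ne {a b : ℕ} (h : b ≠ M a) : moveGT r i M a b = r a b := by
  simp [moveGT, h]

lemma moveGT_of_gt {a b : ℕ} (h : i < a) : moveGT r i M a b = r a b := by
  simp [moveGT, h]

end Admissible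

/-- there are constants `0 < c₁ < c₂` depending only on `q` and
`ℓ` such that for every `1 ≤ i ≤ ℓ+1`, every GT tableau `r` and every move
`M = (m₁, …, m_i)` admissible for `r`,
`c₁ q^{C(i,r,M)} ≤ ∏_{a=1}^{i-1} |X_a|^{1/2} ⬝ |Y_i|^{1/2} ≤ c₂ q^{C(i,r,M)}`. -/
theorem stmt_6 (ℓ : ℕ) (hℓ : 1 ≤ ℓ) (q : ℝ) (hq0 : 0 < q) (hq1 : q < 1) :
    ∃ c₁ c₂ : ℝ, 0 < c₁ ∧ c₁ < c₂ ∧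
      ∀ (i : ℕ) (r : ℕ → ℕ → ℕ) (M : ℕ → ℕ), 1 ≤ i → i ≤ ℓ + 1 → IsGT ℓ r →
        (∀ j, 1 ≤ j → j ≤ i → 1 ≤ M j ∧ M j ≤ ℓ + 2 - j) →
        IsGT ℓ (moveGT r i M) →
        c₁ * q ^ Cexp ℓ i r M ≤
            (∏ a ∈ Finset.Icc 1 (i - 1), Real.sqrt |Xfac ℓ q r a (M a) (M (a + 1))|) *
              Real.sqrt |Yfac ℓ q r i (M i)| ∧
          (∏ a ∈ Finset.Icc 1 (i - 1), Real.sqrt |Xfac ℓ q r a (M a) (M (a + 1))|) *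
              Real.sqrt |Yfac ℓ q r i (M i)| ≤ c₂ * q ^ Cexp ℓ i r M := by
  obtain ⟨N, hN⟩ := exists_qComp_qnum hq0 hq1
  set K : ℕ := 4 * (ℓ + 2) * (N + (ℓ + 2)) + (ℓ + 2) with hK
  set T : ℕ := (ℓ + 2) * K + K with hT
  refine ⟨q ^ T, q ^ (-(T : ℤ)), by positivity, ?_, ?_⟩
  · rw [← zpow_natCast]
    exact zpow_lt_zpow_right_of_lt_one₀ hq0 hq1 (by omega)
  intro i r M hi1 hi hr hM hMr
  have hY : QComp q K (∑ b ∈ Finset.Ico (M i) (ℓ + 2 - i), Hgt r i b)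
      (Real.sqrt |Yfac ℓ q r i (M i)|) := by
    obtain ⟨h1, h2⟩ := hM i hi1 le_rfl
    refine (qComp_Yfac hq0 hq1 hN hr hi1 h1 h2 fun t ht1 htj => ?_).sqrt hq0 hq1
    have h := (hMr.interlaced hi1 t ht1 (by omega)).2
    simp only [htj, moveGT_self hi1 le_rfl, moveGT_of_gt (show i < i + 1 by omega)] at h
    omega
  have hX : ∀ a ∈ Finset.Icc 1 (i - 1), QComp q K
      (∑ b ∈ Finset.Ico (min (M a) (M (a + 1))) (max (M a) (M (a + 1))), Hgt r a b +
        2 * ∑ b ∈ Finset.Ioo (M (a + 1)) (M a), Vgt r a b)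
      (Real.sqrt |Xfac ℓ q r a (M a) (M (a + 1))|) := by
    intro a ha
    rw [Finset.mem_Icc] at ha
    obtain ⟨ha1, hai⟩ := ha
    obtain ⟨hj1, hjn⟩ := hM a ha1 (by omega)
    obtain ⟨hk1, hkn⟩ := hM (a + 1) (by omega) (by omega)
    have hI := hMr.interlaced ha1
    have hself : moveGT r i M a (M a) = r a (M a) + 1 := moveGT_self ha1 (by omega)
    have hself' : moveGT r i M (a + 1) (M (a + 1)) = r (a + 1) (M (a + 1)) + 1 :=
      moveGT_self (by omega) (by omega)
    refine (qComp_Xfac hq0 hq1 hN hr ha1 hj1 hjn hk1 (by omega) (fun hne => ?_)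
      (fun t ht1 htj hne => ?_) (fun t ht1 htk => ?_)).sqrt hq0 hq1
    · have h := (hI _ hk1 (by omega)).1
      simp only [hself', moveGT_of_ne hne] at h
      omega
    · have h := (hI t ht1 (by omega)).2
      simp only [htj, hself, moveGT_of_ne hne] at h
      omega
    · have h := hI.antitone_right ht1 (by omega : t ≤ M (a + 1)) (by omega)
      simp only [hself', moveGT_of_ne (show t ≠ M (a + 1) by omega)] at h
      omega
  have htot := ((QComp.prod_le hq0 hq1 (c := ℓ + 2) (by rw [Nat.card_Icc]; omega) hX).mul
    hq0 hY)
  change QComp q T (Cexp ℓ i r M) _ at htot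
  obtain ⟨hlo, hhi⟩ := htot
  rw [add_comm, zpow_add₀ hq0.ne', zpow_natCast] at hlo
  rw [sub_eq_neg_add, zpow_add₀ hq0.ne'] at hhi
  exact ⟨hlo, hhi⟩
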